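/- arXiv:2503.13922 — 6 statements merged into one kernel-verified Lean document; each statement's English description precedes it below -/
import Mathlib

section
/- Let u be a classical solution of the regularized problem. Then 4·∫_0^T ∫_a^b t·|∂_t((u(t,x) + 1/n)^{1/2})|² dν_λ(x) dt + (T/2)·∫_a^b |∂_x u(T,x)|² dx ≤ (1/2)·∫_0^T ∫_a^b |∂_x u(t,x)|² dx dt + 2·T·A· sup_{t∈[0,T]} ∫_a^b u(t,x) dν_λ(x). -/
open MeasureTheory Set

noncomputable def rho (lam x : ℝ) : ℝ := Real.sqrt x * (x + lam) * Real.sqrt (x + 2 * lam)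

/-- `u` is a classical solution of the regularized Dirichlet problem on `[0,T] × [a,b]`:
nonnegative, continuous, C¹ in time, C² in space, solving
`∂ₜu = ρ_λ(x)(u + 1/n)∂ₓ²u + ρ_λ(x) g(x) (u + 1/n)` with zero lateral boundary data
and initial data `u₀`. -/
structure IsRegSolution (lam a b T : ℝ) (n : ℕ) (g u₀ : ℝ → ℝ) (u : ℝ → ℝ → ℝ) : Prop where
  nonneg : ∀ t ∈ Icc (0:ℝ) T, ∀ x ∈ Icc a b, 0 ≤ u t x
  cont : ContinuousOn (fun p : ℝ × ℝ => u p.1 p.2) (Icc (0:ℝ) T ×ˢ Icc a b)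
  diff_t : ∀ t ∈ Icc (0:ℝ) T, ∀ x ∈ Icc a b, DifferentiableAt ℝ (fun s => u s x) t
  diff_x : ∀ t ∈ Icc (0:ℝ) T, ∀ x ∈ Icc a b, DifferentiableAt ℝ (fun y => u t y) x
  diff_xx : ∀ t ∈ Icc (0:ℝ) T, ∀ x ∈ Icc a b, DifferentiableAt ℝ (deriv (fun y => u t y)) x
  cont_dt : ContinuousOn (fun p : ℝ × ℝ => deriv (fun s => u s p.2) p.1) (Icc (0:ℝ) T ×ˢ Icc a b)
  cont_dx : ContinuousOn (fun p : ℝ × ℝ => deriv (fun y => u p.1 y) p.2) (Icc (0:ℝ) T ×ˢ Icc a b)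
  cont_dxx : ContinuousOn (fun p : ℝ × ℝ => deriv (deriv (fun y => u p.1 y)) p.2) (Icc (0:ℝ) T ×ˢ Icc a b)
  eqn : ∀ t ∈ Icc (0:ℝ) T, ∀ x ∈ Ioo a b,
    deriv (fun s => u s x) t =
      rho lam x * (u t x + 1 / (n:ℝ)) * deriv (deriv (fun y => u t y)) x
        + rho lam x * g x * (u t x + 1 / (n:ℝ))
  bdry_a : ∀ t ∈ Icc (0:ℝ) T, u t a = 0
  bdry_b : ∀ t ∈ Icc (0:ℝ) T, u t b = 0
  init : ∀ x ∈ Icc a b, u 0 x = u₀ x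

open Filter Topology

/-- Freezing the time variable of a function continuous on a rectangle. -/
lemma ContinuousOn.rect_slice {T a b : ℝ} {f : ℝ → ℝ → ℝ}
    (hf : ContinuousOn (fun p : ℝ × ℝ => f p.1 p.2) (Icc (0:ℝ) T ×ˢ Icc a b))
    {t : ℝ} (ht : t ∈ Icc (0:ℝ) T) : ContinuousOn (f t) (Icc a b) :=
  hf.comp (f := fun x => (t, x)) (by fun_prop) fun _ hx => ⟨ht, hx⟩

lemma ContinuousOn.rect_integral {T a b : ℝ} (hT : 0 < T) (hab : a < b) {f : ℝ → ℝ → ℝ}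
    (hf : ContinuousOn (fun p : ℝ × ℝ => f p.1 p.2) (Icc (0:ℝ) T ×ˢ Icc a b)) :
    ContinuousOn (fun t => ∫ x in a..b, f t x) (Icc (0:ℝ) T) := by
  have hF : Continuous (Function.uncurry fun t x : ℝ =>
      f (projIcc 0 T hT.le t) (projIcc a b hab.le x)) :=
    hf.comp_continuous (f := fun p : ℝ × ℝ =>
      ((projIcc 0 T hT.le p.1 : ℝ), (projIcc a b hab.le p.2 : ℝ)))
      (by fun_prop) fun p => ⟨Subtype.coe_prop _, Subtype.coe_prop _⟩
  refine (intervalIntegral.continuous_parametric_intervalIntegral_of_continuous'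
    (μ := volume) hF a b).continuousOn.congr fun t ht => ?_
  refine intervalIntegral.integral_congr fun x hx => ?_
  rw [uIcc_of_le hab.le] at hx
  simp only [projIcc_of_mem _ ht, projIcc_of_mem _ hx]

lemma tendsto_integral_slope_mul {T a b : ℝ} (hab : a < b) {u h : ℝ → ℝ → ℝ}
    (hu : ContinuousOn (fun p : ℝ × ℝ => u p.1 p.2) (Icc (0:ℝ) T ×ˢ Icc a b))
    (hd : ∀ t ∈ Icc (0:ℝ) T, ∀ x ∈ Icc a b, DifferentiableAt ℝ (fun s => u s x) t)
    (hdc : ContinuousOn (fun p : ℝ × ℝ => deriv (fun s => u s p.2) p.1)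
      (Icc (0:ℝ) T ×ˢ Icc a b))
    (hh : ContinuousOn (fun p : ℝ × ℝ => h p.1 p.2) (Icc (0:ℝ) T ×ˢ Icc a b))
    {t : ℝ} (ht : t ∈ Ioo (0:ℝ) T) :
    Tendsto (fun s => ∫ x in a..b, (s - t)⁻¹ * (u s x - u t x) * h s x) (𝓝[≠] t)
      (𝓝 (∫ x in a..b, deriv (fun r => u r x) t * h t x)) := by
  have hK : IsCompact (Icc (0:ℝ) T ×ˢ Icc a b) := isCompact_Icc.prod isCompact_Icc
  obtain ⟨M, hM⟩ := hK.exists_bound_of_continuousOn hdc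
  obtain ⟨K, hK'⟩ := hK.exists_bound_of_continuousOn hh
  have htI : t ∈ Icc (0:ℝ) T := Ioo_subset_Icc_self ht
  have hM0 : 0 ≤ M := (norm_nonneg _).trans (hM (t, a) ⟨htI, left_mem_Icc.2 hab.le⟩)
  have hnear : ∀ᶠ s in 𝓝[≠] t, s ∈ Icc (0:ℝ) T :=
    nhdsWithin_le_nhds (Icc_mem_nhds ht.1 ht.2)
  refine intervalIntegral.tendsto_integral_filter_of_dominated_convergence
    (fun _ => M * K) ?_ ?_ ?_ ?_
  · filter_upwards [hnear] with s hs
    have hc : ContinuousOn (fun x => (s - t)⁻¹ * (u s x - u t x) * h s x) (Icc a b) :=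
      (continuousOn_const.mul ((hu.rect_slice hs).sub (hu.rect_slice htI))).mul
        (hh.rect_slice hs)
    rw [uIoc_of_le hab.le]
    exact (hc.mono Ioc_subset_Icc_self).aestronglyMeasurable measurableSet_Ioc
  · filter_upwards [hnear, self_mem_nhdsWithin] with s hs hst
    refine Eventually.of_forall fun x hx => ?_
    rw [uIoc_of_le hab.le] at hx
    have hx' := Ioc_subset_Icc_self hx
    have hlip := Convex.norm_image_sub_le_of_norm_deriv_le (f := fun r => u r x)
      (fun r hr => hd r hr x hx') (fun r hr => hM (r, x) ⟨hr, hx'⟩) (convex_Icc 0 T) htI hs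
    have hpos : 0 < ‖s - t‖ := norm_pos_iff.2 (sub_ne_zero.2 hst)
    rw [norm_mul, norm_mul, norm_inv]
    refine mul_le_mul ?_ (hK' (s, x) ⟨hs, hx'⟩) (norm_nonneg _) hM0
    rw [inv_mul_le_iff₀ hpos, mul_comm]
    exact hlip
  · exact intervalIntegrable_const
  · refine Eventually.of_forall fun x hx => ?_
    rw [uIoc_of_le hab.le] at hx
    have hx' := Ioc_subset_Icc_self hx
    refine Tendsto.mul ?_ ?_
    · exact (hasDerivAt_iff_tendsto_slope.1 (hd t htI x hx').hasDerivAt)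
    · have h1 : ContinuousOn (fun s => h s x) (Icc 0 T) :=
        hh.comp (f := fun s => (s, x)) (by fun_prop) fun _ hs => ⟨hs, hx'⟩
      exact (h1.continuousAt (Icc_mem_nhds ht.1 ht.2)).tendsto.mono_left nhdsWithin_le_nhds

lemma rho_pos {lam x : ℝ} (hlam : 0 ≤ lam) (hx : 0 < x) : 0 < rho lam x := by
  unfold rho; positivity

lemma continuous_rho (lam : ℝ) : Continuous (rho lam) := by
  unfold rho; fun_prop

namespace IsRegSolution

variable {lam a b T : ℝ} {n : ℕ} {g u₀ : ℝ → ℝ} {u : ℝ → ℝ → ℝ}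

/-- Time derivative of the Dirichlet energy, obtained without differentiating `∂ₓu` in time. -/
lemma hasDerivAt_energy (hu : IsRegSolution lam a b T n g u₀ u) (hab : a < b)
    {t : ℝ} (ht : t ∈ Ioo (0:ℝ) T) :
    HasDerivAt (fun s => (1 / 2) * ∫ x in a..b, (deriv (fun y => u s y) x) ^ 2)
      (-∫ x in a..b, deriv (fun r => u r x) t * deriv (deriv (fun y => u t y)) x) t := by
  have htI : t ∈ Icc (0:ℝ) T := Ioo_subset_Icc_self ht
  have hcxx : ∀ s ∈ Icc (0:ℝ) T, ContinuousOn (deriv (deriv (fun y => u s y))) (Icc a b) :=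
    fun s hs => ContinuousOn.rect_slice (f := fun s => deriv (deriv (fun y => u s y)))
      hu.cont_dxx hs
  have hcx : ∀ s ∈ Icc (0:ℝ) T, ContinuousOn (deriv (fun y => u s y)) (Icc a b) :=
    fun s hs => ContinuousOn.rect_slice (f := fun s => deriv (fun y => u s y)) hu.cont_dx hs
  have key := tendsto_integral_slope_mul hab hu.cont hu.diff_t hu.cont_dt
    (h := fun s x => deriv (deriv (fun y => u s y)) x + deriv (deriv (fun y => u t y)) x)
    (hu.cont_dxx.add ((hcxx t htI).comp continuousOn_snd fun p hp => hp.2)) ht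
  rw [hasDerivAt_iff_tendsto_slope]
  have hlim : (-∫ x in a..b, deriv (fun r => u r x) t * deriv (deriv (fun y => u t y)) x)
      = (-1 / 2) * ∫ x in a..b, deriv (fun r => u r x) t *
        (deriv (deriv (fun y => u t y)) x + deriv (deriv (fun y => u t y)) x) := by
    rw [← intervalIntegral.integral_const_mul, ← intervalIntegral.integral_neg]
    exact intervalIntegral.integral_congr fun x _ => by ring
  rw [hlim]
  refine (key.const_mul (-1 / 2)).congr' ?_
  filter_upwards [nhdsWithin_le_nhds (Icc_mem_nhds ht.1 ht.2)] with s hs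
  have hparts := intervalIntegral.integral_mul_deriv_eq_deriv_mul (a := a) (b := b)
    (u := fun x => u s x - u t x)
    (v := fun x => deriv (fun y => u s y) x + deriv (fun y => u t y) x)
    (u' := fun x => deriv (fun y => u s y) x - deriv (fun y => u t y) x)
    (v' := fun x => deriv (deriv (fun y => u s y)) x + deriv (deriv (fun y => u t y)) x)
    (fun x hx => by
      rw [uIcc_of_le hab.le] at hx
      exact (hu.diff_x s hs x hx).hasDerivAt.sub (hu.diff_x t htI x hx).hasDerivAt)
    (fun x hx => by
      rw [uIcc_of_le hab.le] at hx
      exact (hu.diff_xx s hs x hx).hasDerivAt.add (hu.diff_xx t htI x hx).hasDerivAt)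
    (((hcx s hs).sub (hcx t htI)).intervalIntegrable_of_Icc hab.le)
    (((hcxx s hs).add (hcxx t htI)).intervalIntegrable_of_Icc hab.le)
  simp only [hu.bdry_a s hs, hu.bdry_b s hs, hu.bdry_a t htI, hu.bdry_b t htI, sub_self,
    zero_mul, zero_sub] at hparts
  have hsq : (∫ x in a..b, (deriv (fun y => u s y) x) ^ 2) -
      (∫ x in a..b, (deriv (fun y => u t y) x) ^ 2) =
      ∫ x in a..b, (deriv (fun y => u s y) x - deriv (fun y => u t y) x) *
        (deriv (fun y => u s y) x + deriv (fun y => u t y) x) := by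
    have hi : ∀ r ∈ Icc (0:ℝ) T,
        IntervalIntegrable (fun x => (deriv (fun y => u r y) x) ^ 2) volume a b :=
      fun r hr => ((hcx r hr).pow 2).intervalIntegrable_of_Icc hab.le
    rw [← intervalIntegral.integral_sub (hi s hs) (hi t htI)]
    exact intervalIntegral.integral_congr fun x _ => by ring
  simp only [mul_assoc, intervalIntegral.integral_const_mul, hparts, ← hsq, slope, vsub_eq_sub,
    smul_eq_mul]
  ring

lemma hasDerivAt_integral_mul (hu : IsRegSolution lam a b T n g u₀ u) (hab : a < b)
    (hg : ContinuousOn g (Icc a b)) {t : ℝ} (ht : t ∈ Ioo (0:ℝ) T) :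
    HasDerivAt (fun s => ∫ x in a..b, u s x * g x)
      (∫ x in a..b, deriv (fun r => u r x) t * g x) t := by
  have htI : t ∈ Icc (0:ℝ) T := Ioo_subset_Icc_self ht
  have key := tendsto_integral_slope_mul hab hu.cont hu.diff_t hu.cont_dt
    (h := fun _ x => g x) (hg.comp continuousOn_snd fun p hp => hp.2) ht
  rw [hasDerivAt_iff_tendsto_slope]
  refine key.congr' ?_
  filter_upwards [nhdsWithin_le_nhds (Icc_mem_nhds ht.1 ht.2)] with s hs
  have hi : ∀ r ∈ Icc (0:ℝ) T, IntervalIntegrable (fun x => u r x * g x) volume a b :=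
    fun r hr => ((hu.cont.rect_slice hr).mul hg).intervalIntegrable_of_Icc hab.le
  simp only [slope, vsub_eq_sub, smul_eq_mul]
  rw [← intervalIntegral.integral_sub (hi s hs) (hi t htI),
    ← intervalIntegral.integral_const_mul]
  exact intervalIntegral.integral_congr fun x _ => by ring

lemma four_mul_sq_deriv_sqrt (hu : IsRegSolution lam a b T n g u₀ u) (hlam : 0 ≤ lam)
    (ha : 0 < a) (hn : 1 ≤ n) {t x : ℝ} (ht : t ∈ Icc (0:ℝ) T) (hx : x ∈ Ioo a b) :
    4 * (t * (deriv (fun s => (u s x + 1 / (n:ℝ)) ^ ((1:ℝ)/2)) t) ^ 2 / rho lam x) =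
      t * (deriv (fun r => u r x) t * deriv (deriv (fun y => u t y)) x +
        deriv (fun r => u r x) t * g x) := by
  have hx' := Ioo_subset_Icc_self hx
  have hn' : (0:ℝ) < 1 / n := by positivity
  have hv : 0 < u t x + 1 / (n:ℝ) := add_pos_of_nonneg_of_pos (hu.nonneg t ht x hx') hn'
  have hρ := rho_pos hlam (ha.trans hx.1)
  have hd := ((hu.diff_t t ht x hx').hasDerivAt.add_const (1 / (n:ℝ))).rpow_const
    (p := (1:ℝ) / 2) (Or.inl hv.ne')
  have hpow : ((u t x + 1 / (n:ℝ)) ^ ((1:ℝ) / 2 - 1)) ^ 2 = (u t x + 1 / (n:ℝ))⁻¹ := by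
    rw [← Real.rpow_natCast, ← Real.rpow_mul hv.le, ← Real.rpow_neg_one]
    norm_num
  rw [hd.deriv, mul_pow, mul_pow, hpow, hu.eqn t ht x hx]
  field_simp
  ring

lemma integral_mul_identity (hu : IsRegSolution lam a b T n g u₀ u) (hab : a < b) (hT : 0 < T)
    (hg : ContinuousOn g (Icc a b)) :
    (∫ t in (0:ℝ)..T, ∫ x in a..b, t * (deriv (fun r => u r x) t *
        deriv (deriv (fun y => u t y)) x + deriv (fun r => u r x) t * g x)) +
      T / 2 * ∫ x in a..b, (deriv (fun y => u T y) x) ^ 2 =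
    1 / 2 * (∫ t in (0:ℝ)..T, ∫ x in a..b, (deriv (fun y => u t y) x) ^ 2) +
      (T * (∫ x in a..b, u T x * g x) - ∫ t in (0:ℝ)..T, ∫ x in a..b, u t x * g x) := by
  have hgc : ContinuousOn (fun p : ℝ × ℝ => g p.2) (Icc (0:ℝ) T ×ˢ Icc a b) :=
    hg.comp continuousOn_snd fun p hp => hp.2
  have hE := ContinuousOn.rect_integral hT hab
    (f := fun t x => (deriv (fun y => u t y) x) ^ 2) (hu.cont_dx.pow 2)
  have hG := ContinuousOn.rect_integral hT hab
    (f := fun t x => u t x * g x) (hu.cont.mul hgc)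
  have hP1c := hu.cont_dt.mul hu.cont_dxx
  have hP2c := hu.cont_dt.mul hgc
  have hP := ContinuousOn.rect_integral hT hab
    (f := fun t x => t * (deriv (fun r => u r x) t *
        deriv (deriv (fun y => u t y)) x + deriv (fun r => u r x) t * g x))
    (continuousOn_fst.mul (hP1c.add hP2c))
  have hEi := hE.intervalIntegrable_of_Icc (μ := volume) hT.le
  have hGi := hG.intervalIntegrable_of_Icc (μ := volume) hT.le
  have hPi := hP.intervalIntegrable_of_Icc (μ := volume) hT.le
  have ftc := intervalIntegral.integral_eq_sub_of_hasDerivAt_of_le hT.le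
    (f := fun t => t * ((∫ x in a..b, u t x * g x) -
      (1 / 2) * ∫ x in a..b, (deriv (fun y => u t y) x) ^ 2))
    (f' := fun t => (∫ x in a..b, t * (deriv (fun r => u r x) t *
        deriv (deriv (fun y => u t y)) x + deriv (fun r => u r x) t * g x)) +
      ((∫ x in a..b, u t x * g x) -
        (1 / 2) * ∫ x in a..b, (deriv (fun y => u t y) x) ^ 2))
    (continuousOn_id.mul (hG.sub (continuousOn_const.mul hE)))
    (fun t ht => by
      have htI := Ioo_subset_Icc_self ht
      have := (hasDerivAt_id t).mul
        ((hu.hasDerivAt_integral_mul hab hg ht).sub (hu.hasDerivAt_energy hab ht))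
      refine this.congr_deriv ?_
      have h1 : IntervalIntegrable (fun x => deriv (fun r => u r x) t *
          deriv (deriv (fun y => u t y)) x) volume a b :=
        (ContinuousOn.rect_slice (f := fun t x => deriv (fun r => u r x) t *
          deriv (deriv (fun y => u t y)) x) hP1c htI).intervalIntegrable_of_Icc hab.le
      have h2 : IntervalIntegrable (fun x => deriv (fun r => u r x) t * g x) volume a b :=
        (ContinuousOn.rect_slice (f := fun t x => deriv (fun r => u r x) t * g x)
          hP2c htI).intervalIntegrable_of_Icc hab.le
      rw [intervalIntegral.integral_const_mul, intervalIntegral.integral_add h1 h2]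
      simp only [id, Pi.sub_apply]
      ring)
    (hPi.add (hGi.sub (hEi.const_mul _)))
  rw [intervalIntegral.integral_add hPi (hGi.sub (hEi.const_mul _)),
    intervalIntegral.integral_sub hGi (hEi.const_mul _),
    intervalIntegral.integral_const_mul] at ftc
  linarith

lemma abs_integral_mul_le (hu : IsRegSolution lam a b T n g u₀ u) (hlam : 0 ≤ lam) (ha : 0 < a)
    (hab : a < b) (hg : ContinuousOn g (Icc a b)) {A : ℝ}
    (hA : ∀ x ∈ Ioo a b, |rho lam x * g x| ≤ A) {t : ℝ} (ht : t ∈ Icc (0:ℝ) T) :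
    |∫ x in a..b, u t x * g x| ≤ A * ∫ x in a..b, u t x / rho lam x := by
  have hρ : ∀ x ∈ Icc a b, 0 < rho lam x := fun x hx => rho_pos hlam (ha.trans_le hx.1)
  have hi : ContinuousOn (fun x => u t x / rho lam x) (Icc a b) :=
    (hu.cont.rect_slice ht).div (continuous_rho lam).continuousOn fun x hx => (hρ x hx).ne'
  have hug : ContinuousOn (fun x => u t x * g x) (Icc a b) := (hu.cont.rect_slice ht).mul hg
  rw [← intervalIntegral.integral_const_mul]
  refine (intervalIntegral.abs_integral_le_integral_abs hab.le).trans ?_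
  refine intervalIntegral.integral_mono_on_of_le_Ioo hab.le
    (hug.abs.intervalIntegrable_of_Icc hab.le)
    ((continuousOn_const.mul hi).intervalIntegrable_of_Icc hab.le) fun x hx => ?_
  have hx' := Ioo_subset_Icc_self hx
  have h1 := hA x hx
  rw [abs_mul, abs_of_pos (hρ x hx')] at h1
  rw [abs_mul, abs_of_nonneg (hu.nonneg t ht x hx')]
  calc u t x * |g x| = rho lam x * |g x| * (u t x / rho lam x) := by
        have := (hρ x hx').ne'
        field_simp
    _ ≤ A * (u t x / rho lam x) :=
        mul_le_mul_of_nonneg_right h1 (div_nonneg (hu.nonneg t ht x hx') (hρ x hx').le)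

end IsRegSolution

/-- Time-derivative estimate:
`4∫₀ᵀ∫ t·|∂ₜ((u+1/n)^{1/2})|² dν_λ dt + (T/2)∫ |∂ₓu(T)|²
  ≤ (1/2)∫₀ᵀ∫ |∂ₓu|² + 2·T·A·sup_t ∫ u(t) dν_λ`. -/
theorem time_derivative_estimate
    (lam a b T : ℝ) (n : ℕ) (hlam : 0 ≤ lam) (ha : 0 < a) (hab : a < b) (hT : 0 < T)
    (hn : 1 ≤ n) (g u₀ : ℝ → ℝ) (hg : ContinuousOn g (Icc a b))
    (hu₀c : ContinuousOn u₀ (Icc a b)) (hu₀nn : ∀ x ∈ Icc a b, 0 ≤ u₀ x)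
    (hu₀a : u₀ a = 0) (hu₀b : u₀ b = 0)
    (u : ℝ → ℝ → ℝ) (hu : IsRegSolution lam a b T n g u₀ u)
    (A : ℝ) (hA : IsLUB ((fun x => |rho lam x * g x|) '' Ioo a b) A)
    (S : ℝ) (hS : IsLUB {y : ℝ | ∃ t ∈ Icc (0:ℝ) T, y = ∫ x in Ioo a b, u t x / rho lam x} S) :
    4 * (∫ t in Ioo (0:ℝ) T, ∫ x in Ioo a b,
          t * (deriv (fun s => (u s x + 1 / (n:ℝ)) ^ ((1:ℝ)/2)) t) ^ 2 / rho lam x)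
      + (T / 2) * (∫ x in Ioo a b, (deriv (fun y => u T y) x) ^ 2)
    ≤ (1 / 2) * (∫ t in Ioo (0:ℝ) T, ∫ x in Ioo a b, (deriv (fun y => u t y) x) ^ 2)
      + 2 * T * A * S := by
  have hIoo : ∀ (c d : ℝ), c ≤ d → ∀ f : ℝ → ℝ, ∫ x in Ioo c d, f x = ∫ x in c..d, f x :=
    fun c d h f => by rw [intervalIntegral.integral_of_le h, integral_Ioc_eq_integral_Ioo]
  have hL : 4 * (∫ t in Ioo (0:ℝ) T, ∫ x in Ioo a b,
      t * (deriv (fun s => (u s x + 1 / (n:ℝ)) ^ ((1:ℝ)/2)) t) ^ 2 / rho lam x) =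
      ∫ t in (0:ℝ)..T, ∫ x in a..b, t * (deriv (fun r => u r x) t *
        deriv (deriv (fun y => u t y)) x + deriv (fun r => u r x) t * g x) := by
    rw [← hIoo 0 T hT.le, ← integral_const_mul]
    refine setIntegral_congr_fun measurableSet_Ioo fun t ht => ?_
    rw [← hIoo a b hab.le, ← integral_const_mul]
    exact setIntegral_congr_fun measurableSet_Ioo fun x hx =>
      hu.four_mul_sq_deriv_sqrt hlam ha hn (Ioo_subset_Icc_self ht) hx
  have hA0 : 0 ≤ A := by
    obtain ⟨x, hx⟩ := nonempty_Ioo.2 hab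
    exact (abs_nonneg _).trans (hA.1 (mem_image_of_mem _ hx))
  have hbound : ∀ t ∈ Icc (0:ℝ) T, |∫ x in a..b, u t x * g x| ≤ A * S := fun t ht =>
    (hu.abs_integral_mul_le hlam ha hab hg (fun x hx => hA.1 (mem_image_of_mem _ hx)) ht).trans
      (mul_le_mul_of_nonneg_left (hS.1 ⟨t, ht, (hIoo a b hab.le _).symm⟩) hA0)
  have hmean : |∫ t in (0:ℝ)..T, ∫ x in a..b, u t x * g x| ≤ A * S * T := by
    have := intervalIntegral.norm_integral_le_of_norm_le_const (a := (0:ℝ)) (b := T)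
      (f := fun t => ∫ x in a..b, u t x * g x) (C := A * S) fun t ht => by
        rw [uIoc_of_le hT.le] at ht
        exact hbound t (Ioc_subset_Icc_self ht)
    rwa [sub_zero, abs_of_pos hT] at this
  have hend : T * (∫ x in a..b, u T x * g x) ≤ T * (A * S) :=
    mul_le_mul_of_nonneg_left ((le_abs_self _).trans (hbound T (right_mem_Icc.2 hT.le))) hT.le
  rw [hL]
  simp only [hIoo a b hab.le, hIoo 0 T hT.le]
  rw [hu.integral_mul_identity hab hT hg]
  linarith [(abs_le.1 hmean).1]
end

section
/- (Benilan–Crandall inequality, nonnegative case.) Let u be a classical solution of the regularized problem and suppose g(x) ≥ 0 for all x ∈ [a,b]. Then ∂_t u(t,x) ≥ −(u(t,x) + 1/n)/t for all (t,x) ∈ (0,T] × [a,b]. -/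
open MeasureTheory Set

/-- A function that lies below its value at `t` just before `t` has nonnegative derivative at `t`. -/
theorem HasDerivAt.nonneg_of_le_left {f : ℝ → ℝ} {f' r t : ℝ} (hf : HasDerivAt f f' t) (hrt : r < t)
    (hle : ∀ s ∈ Ioo r t, f s ≤ f t) : 0 ≤ f' := by
  have h := (hasDerivAt_iff_tendsto_slope_left_right.1 hf).1
  refine ge_of_tendsto h ?_
  filter_upwards [Ioo_mem_nhdsLT hrt] with s hs
  rw [slope_def_field]
  exact div_nonneg_of_nonpos (sub_nonpos.2 (hle s hs)) (sub_nonpos.2 hs.2.le)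

/-- Second-order necessary condition at a local minimum. -/
theorem IsLocalMin.deriv_deriv_nonneg {f : ℝ → ℝ} {x : ℝ} (h : IsLocalMin f x)
    (hc : ContinuousAt f x) : 0 ≤ deriv (deriv f) x := by
  by_contra! hneg
  have hmax := isLocalMax_of_deriv_deriv_neg hneg h.deriv_eq_zero hc
  have hconst : f =ᶠ[nhds x] fun _ => f x := by
    filter_upwards [h, hmax] with y h₁ h₂
    exact le_antisymm h₂ h₁
  have h₂ := hconst.deriv.deriv_eq
  simp at h₂
  exact hneg.ne h₂

theorem rho_nonneg {lam x : ℝ} (hlam : 0 ≤ lam) (hx : 0 ≤ x) : 0 ≤ rho lam x := by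
  unfold rho
  positivity

namespace IsRegSolution

variable {lam a b T : ℝ} {n : ℕ} {g u₀ : ℝ → ℝ} {u : ℝ → ℝ → ℝ}

/-- The logarithmic time derivative of `u + 1/n` is bounded. -/
theorem exists_dt_div_le (hu : IsRegSolution lam a b T n g u₀ u) (hn : 1 ≤ n) :
    ∃ M : ℝ, ∀ t ∈ Icc (0 : ℝ) T, ∀ x ∈ Icc a b,
      deriv (fun s => u s x) t / (u t x + 1 / (n : ℝ)) ≤ M := by
  have hn' : (0 : ℝ) < 1 / n := by positivity
  obtain ⟨M, hM⟩ := (isCompact_Icc.prod isCompact_Icc).exists_bound_of_continuousOn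
    (hu.cont_dt.div (hu.cont.add (continuousOn_const (c := 1 / (n : ℝ)))) fun p hp =>
      (add_pos_of_nonneg_of_pos (hu.nonneg p.1 hp.1 p.2 hp.2) hn').ne')
  exact ⟨M, fun t ht x hx => (le_abs_self _).trans (hM (t, x) ⟨ht, hx⟩)⟩

/-- Convexity of a scaled difference of time slices at an interior minimum. -/
theorem le_mul_dxx_of_isMinOn (hu : IsRegSolution lam a b T n g u₀ u) {c s t x : ℝ}
    (hs : s ∈ Icc (0 : ℝ) T) (ht : t ∈ Icc (0 : ℝ) T) (hx : x ∈ Ioo a b)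
    (hmin : IsMinOn (fun y => c * u s y - u t y) (Icc a b) x) :
    deriv (deriv fun y => u t y) x ≤ c * deriv (deriv fun y => u s y) x := by
  have hx' := Ioo_subset_Icc_self hx
  have hloc := hmin.isLocalMin (Icc_mem_nhds hx.1 hx.2)
  have hd : ∀ y ∈ Icc a b, HasDerivAt (fun y => c * u s y - u t y)
      (c * deriv (fun y => u s y) y - deriv (fun y => u t y) y) y := fun y hy =>
    ((hu.diff_x s hs y hy).hasDerivAt.const_mul c).sub (hu.diff_x t ht y hy).hasDerivAt
  have heq : deriv (fun y => c * u s y - u t y) =ᶠ[nhds x]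
      fun y => c * deriv (fun y => u s y) y - deriv (fun y => u t y) y := by
    filter_upwards [Icc_mem_nhds hx.1 hx.2] with y hy using (hd y hy).deriv
  have h₂ := hloc.deriv_deriv_nonneg (hd x hx').continuousAt
  have hd₂ : HasDerivAt (fun y => c * deriv (fun y => u s y) y - deriv (fun y => u t y) y)
      (c * deriv (deriv fun y => u s y) x - deriv (deriv fun y => u t y) x) x :=
    ((hu.diff_xx s hs x hx').hasDerivAt.const_mul c).sub (hu.diff_xx t ht x hx').hasDerivAt
  rw [heq.deriv_eq, hd₂.deriv] at h₂
  linarith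

/-- Comparison of the solution `v = u + 1/n` with the supersolution `c * v (c * t) x`, `c ≥ 1`. -/
theorem le_mul_of_one_le (hu : IsRegSolution lam a b T n g u₀ u) (hlam : 0 ≤ lam) (ha : 0 < a)
    (hn : 1 ≤ n) (hgnn : ∀ x ∈ Icc a b, 0 ≤ g x) {c : ℝ} (hc : 1 ≤ c) {t x : ℝ}
    (ht : 0 ≤ t) (hct : c * t ≤ T) (hx : x ∈ Icc a b) :
    u t x + 1 / (n : ℝ) ≤ c * (u (c * t) x + 1 / (n : ℝ)) := by
  have hc0 : 0 < c := zero_lt_one.trans_le hc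
  have hn' : (0 : ℝ) < 1 / n := by positivity
  obtain ⟨M, hM⟩ := hu.exists_dt_div_le hn
  set τ := T / c
  have hmem : ∀ s ∈ Icc 0 τ, s ∈ Icc (0 : ℝ) T ∧ c * s ∈ Icc (0 : ℝ) T := by
    intro s hs
    have h : c * s ≤ T := by
      have := (le_div_iff₀ hc0).1 hs.2
      linarith
    have h₁ : s ≤ c * s := le_mul_of_one_le_left hs.1 hc
    exact ⟨⟨hs.1, h₁.trans h⟩, mul_nonneg hc0.le hs.1, h⟩
  have ht' : t ∈ Icc 0 τ := ⟨ht, (le_div_iff₀ hc0).2 (by linarith)⟩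
  let d : ℝ → ℝ → ℝ := fun s y => c * (u (c * s) y + 1 / (n : ℝ)) - (u s y + 1 / (n : ℝ))
  let F : ℝ × ℝ → ℝ := fun p => Real.exp (-(M + 1) * p.1) * d p.1 p.2
  have hF : ContinuousOn F (Icc 0 τ ×ˢ Icc a b) := by
    have h₁ : ContinuousOn (fun p : ℝ × ℝ => u p.1 p.2) (Icc 0 τ ×ˢ Icc a b) :=
      hu.cont.mono fun p hp => ⟨(hmem p.1 hp.1).1, hp.2⟩
    have h₂ : ContinuousOn (fun p : ℝ × ℝ => u (c * p.1) p.2) (Icc 0 τ ×ˢ Icc a b) :=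
      hu.cont.comp (f := fun p : ℝ × ℝ => (c * p.1, p.2)) (by fun_prop)
        fun p hp => ⟨(hmem p.1 hp.1).2, hp.2⟩
    have h₃ : ContinuousOn (fun p : ℝ × ℝ => Real.exp (-(M + 1) * p.1))
      (Icc 0 τ ×ˢ Icc a b) := by fun_prop
    exact h₃.mul (((h₂.add continuousOn_const).const_smul c).sub (h₁.add continuousOn_const))
  obtain ⟨⟨t₀, x₀⟩, ⟨ht₀, hx₀⟩, hmin⟩ :=
    (isCompact_Icc.prod isCompact_Icc).exists_isMinOn ⟨(t, x), ht', hx⟩ hF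
  dsimp only at ht₀ hx₀
  by_contra! hlt
  have hd0 : d t₀ x₀ < 0 := by
    have h₁ : F (t₀, x₀) ≤ F (t, x) := hmin (a := (t, x)) ⟨ht', hx⟩
    have h₂ : F (t, x) < 0 := mul_neg_of_pos_of_neg (Real.exp_pos _) (sub_neg.2 hlt)
    exact (pos_iff_neg_of_mul_neg (h₁.trans_lt h₂)).1 (Real.exp_pos _)
  obtain ⟨htT, hctT⟩ := hmem t₀ ht₀
  have hA : 0 < u (c * t₀) x₀ + 1 / (n : ℝ) :=
    add_pos_of_nonneg_of_pos (hu.nonneg _ hctT _ hx₀) hn'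
  have hB : 0 < u t₀ x₀ + 1 / (n : ℝ) := add_pos_of_nonneg_of_pos (hu.nonneg _ htT _ hx₀) hn'
  have hcn : 1 / (n : ℝ) ≤ c * (1 / (n : ℝ)) := le_mul_of_one_le_left hn'.le hc
  have ht₀pos : 0 < t₀ := by
    refine ht₀.1.lt_of_ne fun h => hd0.not_ge ?_
    simp only [d, ← h, mul_zero, sub_nonneg]
    rw [← h, mul_zero] at hA
    exact le_mul_of_one_le_left hA.le hc
  have hxa : a < x₀ := by
    refine hx₀.1.lt_of_ne fun h => hd0.not_ge ?_
    simp only [d, ← h, hu.bdry_a _ htT, hu.bdry_a _ hctT, zero_add, sub_nonneg]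
    exact hcn
  have hxb : x₀ < b := by
    refine hx₀.2.lt_of_ne fun h => hd0.not_ge ?_
    simp only [d, h, hu.bdry_b _ htT, hu.bdry_b _ hctT, zero_add, sub_nonneg]
    exact hcn
  have hxx := hu.le_mul_dxx_of_isMinOn (c := c) hctT htT ⟨hxa, hxb⟩ (by
    intro y hy
    have h₁ : F (t₀, x₀) ≤ F (t₀, y) := hmin (a := (t₀, y)) ⟨ht₀, hy⟩
    have h₂ : d t₀ x₀ ≤ d t₀ y := le_of_mul_le_mul_left h₁ (Real.exp_pos _)
    simp only [d] at h₂
    simp only [mem_ofPred_eq]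
    linarith)
  have htime : c ^ 2 * deriv (fun s => u s x₀) (c * t₀) - deriv (fun s => u s x₀) t₀
      ≤ (M + 1) * d t₀ x₀ := by
    have hu₁ : HasDerivAt (fun s => u (c * s) x₀) (deriv (fun s => u s x₀) (c * t₀) * c) t₀ :=
      (hu.diff_t _ hctT _ hx₀).hasDerivAt.comp t₀ (by simpa using (hasDerivAt_id t₀).const_mul c)
    have hd := ((hu₁.add_const (1 / (n : ℝ))).const_mul c).sub
      ((hu.diff_t _ htT _ hx₀).hasDerivAt.add_const (1 / (n : ℝ)))
    have he : HasDerivAt (fun s => Real.exp (-(M + 1) * s))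
        (Real.exp (-(M + 1) * t₀) * -(M + 1)) t₀ := by
      simpa using ((hasDerivAt_id t₀).const_mul (-(M + 1))).exp
    have hneg := (he.mul hd).neg.nonneg_of_le_left ht₀pos (fun s hs => neg_le_neg
      (hmin (a := (s, x₀)) ⟨⟨hs.1.le, hs.2.le.trans ht₀.2⟩, hx₀⟩))
    have hfac : 0 ≤ Real.exp (-(M + 1) * t₀) * ((M + 1) * d t₀ x₀ -
        (c ^ 2 * deriv (fun s => u s x₀) (c * t₀) - deriv (fun s => u s x₀) t₀)) := by
      convert hneg using 1
      simp only [d, Pi.sub_apply]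
      ring
    exact sub_nonneg.1 (nonneg_of_mul_nonneg_right hfac (Real.exp_pos _))
  have hm := hM t₀ htT x₀ hx₀
  have hρ := rho_nonneg hlam (ha.trans hxa).le
  have hgx := hgnn x₀ hx₀
  rw [hu.eqn _ hctT _ ⟨hxa, hxb⟩, hu.eqn _ htT _ ⟨hxa, hxb⟩] at htime
  rw [hu.eqn _ htT _ ⟨hxa, hxb⟩, div_le_iff₀ hB] at hm
  simp only [d] at hd0 htime
  set A := u (c * t₀) x₀ + 1 / (n : ℝ)
  set B := u t₀ x₀ + 1 / (n : ℝ)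
  set P := deriv (deriv fun y => u (c * t₀) y) x₀
  set Q := deriv (deriv fun y => u t₀ y) x₀
  have hm' : rho lam x₀ * (Q + g x₀) ≤ M := le_of_mul_le_mul_right (by linarith) hB
  have hPQ : Q + g x₀ ≤ c * P + c * g x₀ := add_le_add hxx (le_mul_of_one_le_left hgx hc)
  have h₁ := mul_le_mul_of_nonneg_left hPQ (mul_nonneg (mul_pos hc0 hA).le hρ)
  have h₂ : (M + 1 - rho lam x₀ * (Q + g x₀)) * (c * A - B) < 0 :=
    mul_neg_of_pos_of_neg (by linarith) hd0
  linarith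

end IsRegSolution

/-- Benilan–Crandall inequality, nonnegative case: if `g ≥ 0` on `[a,b]`, then
`∂ₜu(t,x) ≥ -(u(t,x)+1/n)/t` on `(0,T] × [a,b]`. -/
theorem benilan_crandall_nonneg
    (lam a b T : ℝ) (n : ℕ) (hlam : 0 ≤ lam) (ha : 0 < a) (hab : a < b) (hT : 0 < T)
    (hn : 1 ≤ n) (g u₀ : ℝ → ℝ) (hg : ContinuousOn g (Icc a b))
    (hu₀c : ContinuousOn u₀ (Icc a b)) (hu₀nn : ∀ x ∈ Icc a b, 0 ≤ u₀ x)
    (hu₀a : u₀ a = 0) (hu₀b : u₀ b = 0)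
    (u : ℝ → ℝ → ℝ) (hu : IsRegSolution lam a b T n g u₀ u)
    (hgnn : ∀ x ∈ Icc a b, 0 ≤ g x) :
    ∀ t ∈ Ioc (0:ℝ) T, ∀ x ∈ Icc a b,
      deriv (fun s => u s x) t ≥ -((u t x + 1 / (n:ℝ)) / t) := by
  intro t ht x hx
  have htT : t ∈ Icc (0 : ℝ) T := ⟨ht.1.le, ht.2⟩
  have hd := (hasDerivAt_id t).mul
    ((hu.diff_t t htT x hx).hasDerivAt.add_const (1 / (n : ℝ)))
  have h := hd.nonneg_of_le_left ht.1 (fun s hs => by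
    have hcs : t / s * s = t := div_mul_cancel₀ t hs.1.ne'
    have h₁ := hu.le_mul_of_one_le hlam ha hn hgnn ((one_le_div hs.1).2 hs.2.le) hs.1.le
      (hcs.trans_le ht.2) hx
    rw [hcs] at h₁
    have h₂ := mul_le_mul_of_nonneg_left h₁ hs.1.le
    rwa [← mul_assoc, mul_comm s (t / s), hcs] at h₂)
  simp only [id, one_mul] at h
  rw [ge_iff_le, ← neg_div, div_le_iff₀ ht.1]
  linarith
end

section
/- (Integrable plus semi-subharmonic implies locally bounded.) Let d ≥ 1, x₀ ∈ ℝ^d, R > 0, and N ≥ 0. Let g : ℝ^d → ℝ be nonnegative, twice continuously differentiable on the open ball B_{2R}(x₀), integrable over B_{2R}(x₀), and satisfy Δg(x) ≥ −N for all x ∈ B_{2R}(x₀), where Δg denotes the Laplacian (the sum of the second partial derivatives). Then for every x' ∈ B_R(x₀), g(x') ≤ ( ∫_{B_{2R}(x₀)} g(x) dx ) / ( ω_d·R^d ) + N·R²/(2d), where ω_d is the Lebesgue measure of the unit ball in ℝ^d. -/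
open MeasureTheory Set

section MeanValue

open Metric Filter Topology

variable {E : Type*} [NormedAddCommGroup E]

/-- The Lipschitz potential `(1 - ‖y‖²)₊ / 2`, whose gradient is `-y` on the unit ball. -/
noncomputable def unitBallPotential (y : E) : ℝ := (1 - (min ‖y‖ 1) ^ 2) / 2

lemma unitBallPotential_nonneg (y : E) : 0 ≤ unitBallPotential y := by
  have h0 : 0 ≤ min ‖y‖ 1 := le_min (norm_nonneg y) zero_le_one
  have h1 : min ‖y‖ 1 ≤ 1 := min_le_right _ _
  unfold unitBallPotential
  nlinarith

lemma unitBallPotential_of_le {y : E} (hy : 1 ≤ ‖y‖) : unitBallPotential y = 0 := by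
  simp [unitBallPotential, min_eq_right hy]

lemma unitBallPotential_of_lt {y : E} (hy : ‖y‖ < 1) :
    unitBallPotential y = (1 - ‖y‖ ^ 2) / 2 := by
  simp [unitBallPotential, min_eq_left hy.le]

lemma lipschitzWith_unitBallPotential : LipschitzWith 1 (unitBallPotential : E → ℝ) := by
  refine LipschitzWith.of_dist_le_mul fun x y => ?_
  have hx0 : 0 ≤ min ‖x‖ 1 := le_min (norm_nonneg x) zero_le_one
  have hy0 : 0 ≤ min ‖y‖ 1 := le_min (norm_nonneg y) zero_le_one
  have hx1 : min ‖x‖ 1 ≤ 1 := min_le_right _ _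
  have hy1 : min ‖y‖ 1 ≤ 1 := min_le_right _ _
  have hmin : |min ‖x‖ 1 - min ‖y‖ 1| ≤ ‖x - y‖ := by
    refine (abs_min_sub_min_le_max _ _ _ _).trans ?_
    simpa using abs_norm_sub_norm_le x y
  rw [Real.dist_eq, dist_eq_norm, NNReal.coe_one, one_mul]
  have hfac : unitBallPotential x - unitBallPotential y
      = -((min ‖x‖ 1 - min ‖y‖ 1) * ((min ‖x‖ 1 + min ‖y‖ 1) / 2)) := by
    unfold unitBallPotential
    ring
  rw [hfac, abs_neg, abs_mul]
  have hsum : |(min ‖x‖ 1 + min ‖y‖ 1) / 2| ≤ 1 := by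
    rw [abs_of_nonneg (by linarith)]
    linarith
  exact (mul_le_of_le_one_right (abs_nonneg _) hsum).trans hmin

variable [InnerProductSpace ℝ E]

lemma lineDeriv_unitBallPotential_of_lt {y : E} (hy : ‖y‖ < 1) (v : E) :
    lineDeriv ℝ unitBallPotential y v = -inner ℝ y v := by
  have heq : (unitBallPotential : E → ℝ) =ᶠ[𝓝 y] fun z => (1 - ‖z‖ ^ 2) / 2 := by
    filter_upwards [isOpen_lt continuous_norm continuous_const |>.mem_nhds hy] with z hz
    exact unitBallPotential_of_lt hz
  have hd : HasFDerivAt (fun z : E => (1 - ‖z‖ ^ 2) / 2)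
      ((2⁻¹ : ℝ) • -((2 : ℕ) • (innerSL ℝ y))) y := by
    have := ((hasStrictFDerivAt_norm_sq y).hasFDerivAt.const_sub 1).const_mul (2⁻¹ : ℝ)
    refine this.congr_of_eventuallyEq (Eventually.of_forall fun z => ?_)
    simp only []
    ring
  rw [heq.lineDeriv_eq, (hd.hasLineDerivAt v).lineDeriv]
  simp

lemma lineDeriv_unitBallPotential_of_gt {y : E} (hy : 1 < ‖y‖) (v : E) :
    lineDeriv ℝ unitBallPotential y v = 0 := by
  have heq : (unitBallPotential : E → ℝ) =ᶠ[𝓝 y] fun _ => 0 := by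
    filter_upwards [isOpen_lt continuous_const continuous_norm |>.mem_nhds hy] with z hz
    exact unitBallPotential_of_le (le_of_lt hz)
  rw [heq.lineDeriv_eq]
  simp [lineDeriv]

lemma fderiv_comp_add_smul {F : Type*} [NormedAddCommGroup F] [NormedSpace ℝ F] (f : E → F)
    (a : E) (r : ℝ) (x : E) :
    fderiv ℝ (fun y => f (a + r • y)) x = r • fderiv ℝ f (a + r • x) := by
  rw [fderiv_comp_smul (f := fun y => f (a + y)), fderiv_comp_add_left]

lemma fderiv_fderiv_add_mul_normSq {g : E → ℝ} {x : E} (hg : ContDiffAt ℝ 2 g x) (a v : E)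
    (c : ℝ) :
    fderiv ℝ (fun y => fderiv ℝ (fun z => g z + c * ‖z - a‖ ^ 2) y v) x v
      = fderiv ℝ (fun y => fderiv ℝ g y v) x v + 2 * c * ‖v‖ ^ 2 := by
  have hinner : ∀ y, HasFDerivAt (fun z : E => c * ‖z - a‖ ^ 2)
      (c • (2 : ℕ) • innerSL ℝ (y - a)) y := fun y => by
    have := (((hasStrictFDerivAt_norm_sq (y - a)).hasFDerivAt.comp y
      ((hasFDerivAt_id y).sub_const a)).const_mul c)
    simpa [Function.comp_def] using this
  have hfirst : (fun y => fderiv ℝ (fun z => g z + c * ‖z - a‖ ^ 2) y v) =ᶠ[𝓝 x]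
      fun y => fderiv ℝ g y v + 2 * c * inner ℝ (y - a) v := by
    filter_upwards [hg.eventually (by simp)] with y hy
    rw [((hy.differentiableAt (by simp)).hasFDerivAt.fun_add (hinner y)).fderiv]
    simp only [_root_.add_apply, _root_.smul_apply, innerSL_apply_apply,
      smul_eq_mul]
    ring
  have hg1 : DifferentiableAt ℝ (fun y => fderiv ℝ g y v) x :=
    ((hg.fderiv_right (m := 1) (by norm_num)).clm_apply contDiffAt_const).differentiableAt
      (by simp)
  have hin : HasFDerivAt (fun y : E => 2 * c * inner ℝ (y - a) v)
      ((2 * c) • innerSL ℝ v) x := by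
    have := ((innerSL ℝ v).hasFDerivAt.comp x ((hasFDerivAt_id x).sub_const a)).const_mul (2 * c)
    simpa [Function.comp_def, real_inner_comm] using this
  rw [hfirst.fderiv_eq, (hg1.hasFDerivAt.fun_add hin).fderiv]
  simp

variable [FiniteDimensional ℝ E]

lemma hasCompactSupport_unitBallPotential : HasCompactSupport (unitBallPotential : E → ℝ) := by
  refine HasCompactSupport.intro (isCompact_closedBall (0 : E) 1) fun x hx => ?_
  rw [mem_closedBall_zero_iff, not_le] at hx
  exact unitBallPotential_of_le hx.le

variable [MeasurableSpace E] [BorelSpace E]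

lemma setIntegral_inner_mul_fderiv_eq {f : E → ℝ} (hf : ContDiff ℝ 2 f)
    (hfs : HasCompactSupport f) (v : E) :
    ∫ y in ball (0 : E) 1, inner ℝ y v * fderiv ℝ f y v
      = ∫ y, fderiv ℝ (fun z => fderiv ℝ f z v) y v * unitBallPotential y := by
  have hf1 : ContDiff ℝ 1 (fun z => fderiv ℝ f z v) :=
    (hf.fderiv_right (m := 1) (by norm_num)).clm_apply contDiff_const
  have hf1s : HasCompactSupport (fun z => fderiv ℝ f z v) := hfs.fderiv_apply (𝕜 := ℝ) v
  obtain ⟨C, hC⟩ := hf1.lipschitzWith_of_hasCompactSupport hf1s (by simp)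
  have key := lipschitzWith_unitBallPotential.integral_lineDeriv_mul_eq (μ := volume) hC hf1s v
  have hright : ∀ y, lineDeriv ℝ (fun z => fderiv ℝ f z v) y (-v)
      = -fderiv ℝ (fun z => fderiv ℝ f z v) y v := fun y => by
    rw [((hf1.differentiable (by simp)) y).lineDeriv_eq_fderiv, map_neg]
  have hleft : (fun y => lineDeriv ℝ unitBallPotential y v * fderiv ℝ f y v) =ᵐ[volume]
      (ball (0 : E) 1).indicator (fun y => -(inner ℝ y v * fderiv ℝ f y v)) := by
    have hsph : volume (sphere (0 : E) 1) = 0 :=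
      Measure.addHaar_sphere_of_ne_zero _ _ one_ne_zero
    filter_upwards [measure_eq_zero_iff_ae_notMem.1 hsph] with y hy
    rw [mem_sphere_zero_iff_norm] at hy
    rcases lt_or_gt_of_ne hy with h | h
    · rw [indicator_of_mem (by simpa using h), lineDeriv_unitBallPotential_of_lt h, neg_mul]
    · rw [indicator_of_notMem (by simpa using h.le), lineDeriv_unitBallPotential_of_gt h, zero_mul]
  rw [integral_congr_ae hleft, integral_indicator measurableSet_ball, integral_neg] at key
  simp only [hright, neg_mul, integral_neg, neg_inj] at key
  exact key

lemma setIntegral_fderiv_self_nonneg {ι : Type*} [Fintype ι] (b : OrthonormalBasis ι ℝ E)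
    {f : E → ℝ} (hf : ContDiff ℝ 2 f) (hfs : HasCompactSupport f)
    (hΔ : ∀ x ∈ ball (0 : E) 1, 0 ≤ ∑ i, fderiv ℝ (fun y => fderiv ℝ f y (b i)) x (b i)) :
    0 ≤ ∫ y in ball (0 : E) 1, fderiv ℝ f y y := by
  have hf1 : ∀ v, ContDiff ℝ 1 (fun z => fderiv ℝ f z v) := fun v =>
    (hf.fderiv_right (m := 1) (by norm_num)).clm_apply contDiff_const
  have hexp : ∀ y, fderiv ℝ f y y = ∑ i, inner ℝ y (b i) * fderiv ℝ f y (b i) := fun y => by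
    calc fderiv ℝ f y y = fderiv ℝ f y (∑ i, inner ℝ (b i) y • b i) := by rw [b.sum_repr' y]
      _ = _ := by simp only [map_sum, map_smul, smul_eq_mul, real_inner_comm]
  simp_rw [hexp]
  rw [integral_finsetSum]
  · simp_rw [setIntegral_inner_mul_fderiv_eq hf hfs]
    rw [← integral_finsetSum]
    · refine integral_nonneg fun y => ?_
      simp only [← Finset.sum_mul, Pi.zero_apply]
      by_cases hy : ‖y‖ < 1
      · exact mul_nonneg (hΔ y (by simpa using hy)) (unitBallPotential_nonneg y)
      · rw [unitBallPotential_of_le (not_lt.1 hy), mul_zero]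
    · intro i _
      refine Continuous.integrable_of_hasCompactSupport ?_
        hasCompactSupport_unitBallPotential.mul_left
      exact (((hf1 (b i)).continuous_fderiv (by simp)).clm_apply continuous_const).mul
        lipschitzWith_unitBallPotential.continuous
  · intro i _
    refine Integrable.integrableOn (Continuous.integrable_of_hasCompactSupport ?_
      (hfs.fderiv_apply (𝕜 := ℝ) (b i)).mul_left)
    exact (continuous_id.inner continuous_const).mul (hf1 (b i)).continuous

lemma hasDerivAt_setIntegral_unitBall_comp {f : E → ℝ} (hf : ContDiff ℝ 1 f)
    (hfs : HasCompactSupport f) (a : E) (r : ℝ) :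
    HasDerivAt (fun t : ℝ => ∫ y in ball (0 : E) 1, f (a + t • y))
      (∫ y in ball (0 : E) 1, fderiv ℝ f (a + r • y) y) r := by
  have hcont : Continuous (fderiv ℝ f) := hf.continuous_fderiv (by simp)
  obtain ⟨C, hC⟩ := hcont.bounded_above_of_compact_support (hfs.fderiv (𝕜 := ℝ))
  have hfin : IsFiniteMeasure (volume.restrict (ball (0 : E) 1)) :=
    ⟨by simpa using measure_ball_lt_top⟩
  have hfc : ∀ t : ℝ, Continuous fun y : E => f (a + t • y) := fun t =>
    hf.continuous.comp (by fun_prop)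
  obtain ⟨D, hD⟩ := hf.continuous.bounded_above_of_compact_support hfs
  refine (hasDerivAt_integral_of_dominated_loc_of_deriv_le (s := univ) (bound := fun _ => C)
    (F := fun t y => f (a + t • y)) (F' := fun t y => fderiv ℝ f (a + t • y) y)
    univ_mem ?_ ?_ ?_ ?_ (integrable_const C) ?_).2
  · exact Eventually.of_forall fun t => (hfc t).aestronglyMeasurable
  · exact Integrable.of_bound (hfc r).aestronglyMeasurable D (ae_of_all _ fun y => hD _)
  · exact ((hcont.comp (by fun_prop : Continuous fun y : E => a + r • y)).clm_apply
      continuous_id).aestronglyMeasurable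
  · filter_upwards [ae_restrict_mem measurableSet_ball] with y hy t _
    have hy1 : ‖y‖ ≤ 1 := (mem_ball_zero_iff.1 hy).le
    calc ‖fderiv ℝ f (a + t • y) y‖ ≤ ‖fderiv ℝ f (a + t • y)‖ * ‖y‖ :=
          ContinuousLinearMap.le_opNorm _ _
      _ ≤ ‖fderiv ℝ f (a + t • y)‖ := mul_le_of_le_one_right (norm_nonneg _) hy1
      _ ≤ C := hC _
  · refine ae_of_all _ fun y t _ => ?_
    have hline : HasDerivAt (fun t : ℝ => a + t • y) y t := by
      simpa using ((hasDerivAt_id t).smul_const y).const_add a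
    exact ((hf.differentiable (by simp)) _).hasFDerivAt.comp_hasDerivAt t hline

/-- Sub-mean value property over balls for compactly supported `C²` functions which are
subharmonic on the ball. -/
lemma mul_volume_ball_le_setIntegral {ι : Type*} [Fintype ι] (b : OrthonormalBasis ι ℝ E)
    {f : E → ℝ} (hf : ContDiff ℝ 2 f) (hfs : HasCompactSupport f) (a : E) {R : ℝ} (hR : 0 < R)
    (hΔ : ∀ x ∈ ball a R, 0 ≤ ∑ i, fderiv ℝ (fun y => fderiv ℝ f y (b i)) x (b i)) :
    f a * (volume (ball a R)).toReal ≤ ∫ x in ball a R, f x := by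
  have hderiv := hasDerivAt_setIntegral_unitBall_comp (hf.of_le (by norm_num)) hfs a
  have hmono : MonotoneOn (fun t : ℝ => ∫ y in ball (0 : E) 1, f (a + t • y)) (Icc 0 R) := by
    refine monotoneOn_of_deriv_nonneg (convex_Icc 0 R)
      (fun t _ => (hderiv t).continuousAt.continuousWithinAt)
      (fun t _ => (hderiv t).differentiableAt.differentiableWithinAt) fun r hr => ?_
    rw [interior_Icc] at hr
    rw [(hderiv r).deriv]
    have hemb : Topology.IsClosedEmbedding fun y : E => a + r • y :=
      ((Homeomorph.smulOfNeZero r hr.1.ne').trans (Homeomorph.addLeft a)).isClosedEmbedding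
    have h := setIntegral_fderiv_self_nonneg b (f := fun y => f (a + r • y))
      (hf.comp (by fun_prop)) (hfs.comp_isClosedEmbedding hemb) ?_
    · simp only [fderiv_comp_add_smul, _root_.smul_apply, smul_eq_mul,
        integral_const_mul] at h
      exact nonneg_of_mul_nonneg_right h hr.1
    · intro x hx
      have hmem : a + r • x ∈ ball a R := by
        rw [mem_ball_iff_norm, add_sub_cancel_left, norm_smul, Real.norm_of_nonneg hr.1.le]
        have := mem_ball_zero_iff.1 hx
        nlinarith [hr.1, hr.2]
      have hcalc : ∀ i, fderiv ℝ (fun y => fderiv ℝ (fun z => f (a + r • z)) y (b i)) x (b i)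
          = r ^ 2 * fderiv ℝ (fun y => fderiv ℝ f y (b i)) (a + r • x) (b i) := fun i => by
        simp only [fderiv_comp_add_smul, _root_.smul_apply]
        rw [fderiv_comp_add_smul (fun z => r • fderiv ℝ f z (b i)), fderiv_fun_const_smul
            (((hf.fderiv_right (m := 1) (by norm_num)).clm_apply contDiff_const).differentiable
              (by simp) _)]
        simp only [_root_.smul_apply, smul_eq_mul]
        ring
      simp only [hcalc, ← Finset.mul_sum]
      exact mul_nonneg (sq_nonneg r) (hΔ _ hmem)
  have h0R := hmono (left_mem_Icc.2 hR.le) (right_mem_Icc.2 hR.le) hR.le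
  have hchange : ∫ y in ball (0 : E) 1, f (a + R • y)
      = (R ^ Module.finrank ℝ E)⁻¹ * ∫ x in ball a R, f x := by
    rw [Measure.setIntegral_comp_smul_of_pos volume (fun y => f (a + y)) _ hR, smul_unitBall hR.ne',
      Real.norm_of_nonneg hR.le, smul_eq_mul]
    congr 1
    have := (measurePreserving_add_left (volume : Measure E) a).setIntegral_preimage_emb
      (measurableEmbedding_addLeft a) f (ball a R)
    simpa using this
  simp only [zero_smul, add_zero, setIntegral_const, smul_eq_mul, hchange] at h0R
  rw [Measure.addHaar_ball_of_pos _ _ hR, ENNReal.toReal_mul,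
    ENNReal.toReal_ofReal (by positivity)]
  have hpow : 0 < R ^ Module.finrank ℝ E := by positivity
  rw [inv_mul_eq_div, le_div_iff₀ hpow, Measure.real] at h0R
  linarith

end MeanValue


/-- Integrable plus semi-subharmonic implies locally bounded: if `g ≥ 0` is `C²`
on `B_{2R}(x₀) ⊆ ℝ^d`, integrable there, and `Δg ≥ -N`, then for `x' ∈ B_R(x₀)`,
`g(x') ≤ (∫_{B_{2R}(x₀)} g) / (ω_d R^d) + N R² / (2d)`. -/
theorem integrable_semisubharmonic_locally_bounded
    (d : ℕ) (hd : 1 ≤ d) (x₀ : EuclideanSpace ℝ (Fin d)) (R N : ℝ) (hR : 0 < R)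
    (hN : 0 ≤ N) (g : EuclideanSpace ℝ (Fin d) → ℝ)
    (hgnn : ∀ x, 0 ≤ g x)
    (hgC2 : ContDiffOn ℝ 2 g (Metric.ball x₀ (2 * R)))
    (hgint : IntegrableOn g (Metric.ball x₀ (2 * R)))
    (hsub : ∀ x ∈ Metric.ball x₀ (2 * R),
      -N ≤ ∑ i : Fin d,
        fderiv ℝ (fun y => fderiv ℝ g y (EuclideanSpace.single i 1)) x
          (EuclideanSpace.single i 1))
    (x' : EuclideanSpace ℝ (Fin d)) (hx' : x' ∈ Metric.ball x₀ R) :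
    g x' ≤ (∫ x in Metric.ball x₀ (2 * R), g x) /
        ((volume (Metric.ball (0 : EuclideanSpace ℝ (Fin d)) 1)).toReal * R ^ d)
      + N * R ^ 2 / (2 * d) := by
  have hd0 : (0 : ℝ) < d := by exact_mod_cast hd
  set c : ℝ := N / (2 * d) with hc
  have hc0 : 0 ≤ c := by positivity
  have hdist : dist x' x₀ < R := hx'
  let χ : ContDiffBump x' := ⟨R, R + (R - dist x' x₀) / 2, hR, by linarith⟩
  have hχsub : tsupport χ ⊆ Metric.ball x₀ (2 * R) := by
    rw [χ.tsupport_eq]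
    exact Metric.closedBall_subset_ball' (by change R + (R - dist x' x₀) / 2 + _ < _; linarith)
  have hballsub : Metric.ball x' R ⊆ Metric.ball x₀ (2 * R) :=
    Metric.ball_subset_ball' (by linarith)
  have hgAt : ∀ x ∈ Metric.ball x₀ (2 * R), ContDiffAt ℝ 2 g x := fun x hx =>
    hgC2.contDiffAt (Metric.isOpen_ball.mem_nhds hx)
  have hf : ContDiff ℝ 2 fun x => χ x * (g x + c * ‖x - x'‖ ^ 2) := by
    refine contDiff_iff_contDiffAt.2 fun x => ?_
    by_cases hx : x ∈ tsupport χ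
    swap
    · refine contDiffAt_const (c := (0 : ℝ)) |>.congr_of_eventuallyEq ?_
      filter_upwards [(isClosed_tsupport χ).isOpen_compl.mem_nhds hx] with y hy
      rw [image_eq_zero_of_notMem_tsupport hy, zero_mul]
    refine χ.contDiffAt.mul ((hgAt x (hχsub hx)).add ?_)
    exact (contDiff_const.mul ((contDiff_id.sub contDiff_const).norm_sq ℝ)).contDiffAt
  have hχ1 : ∀ x ∈ Metric.ball x' R, χ x = 1 := fun x hx =>
    χ.one_of_mem_closedBall (Metric.ball_subset_closedBall hx)
  have hmean := mul_volume_ball_le_setIntegral (EuclideanSpace.basisFun (Fin d) ℝ) hf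
    χ.hasCompactSupport.mul_right x' hR fun x hx => by
      have heq := Filter.EventuallyEq.fderiv (𝕜 := ℝ)
        (f₁ := fun x => χ x * (g x + c * ‖x - x'‖ ^ 2)) (f := fun x => g x + c * ‖x - x'‖ ^ 2)
        (x := x) (by
          filter_upwards [Metric.isOpen_ball.mem_nhds hx] with y hy
          simp [hχ1 y hy])
      have hi : ∀ i : Fin d, fderiv ℝ (fun y => fderiv ℝ
          (fun x => χ x * (g x + c * ‖x - x'‖ ^ 2)) y (EuclideanSpace.single i 1)) x
            (EuclideanSpace.single i 1)
          = fderiv ℝ (fun y => fderiv ℝ g y (EuclideanSpace.single i 1)) x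
            (EuclideanSpace.single i 1) + 2 * c := fun i => by
        have hev : (fun y => fderiv ℝ (fun x => χ x * (g x + c * ‖x - x'‖ ^ 2)) y
            (EuclideanSpace.single i 1)) =ᶠ[nhds x]
            fun y => fderiv ℝ (fun x => g x + c * ‖x - x'‖ ^ 2) y (EuclideanSpace.single i 1) :=
          heq.mono fun y hy => by simp only [hy]
        rw [hev.fderiv_eq, fderiv_fderiv_add_mul_normSq (hgAt x (hballsub hx))]
        simp
      have hcd : (d : ℝ) * (2 * c) = N := by
        rw [hc]
        field_simp
      simp only [EuclideanSpace.basisFun_apply, hi, Finset.sum_add_distrib, Finset.sum_const,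
        Finset.card_univ, Fintype.card_fin, nsmul_eq_mul, hcd]
      linarith [hsub x (hballsub hx)]
  have hvol : (volume (Metric.ball x' R)).toReal
      = (volume (Metric.ball (0 : EuclideanSpace ℝ (Fin d)) 1)).toReal * R ^ d := by
    rw [Measure.addHaar_ball_of_pos _ _ hR, ENNReal.toReal_mul,
      ENNReal.toReal_ofReal (by positivity), finrank_euclideanSpace_fin, mul_comm]
  have hVpos : 0 < (volume (Metric.ball x' R)).toReal :=
    ENNReal.toReal_pos (Metric.measure_ball_pos _ _ hR).ne' measure_ball_lt_top.ne
  have hgR : IntegrableOn g (Metric.ball x' R) := hgint.mono_set hballsub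
  have hconst : IntegrableOn (fun _ => c * R ^ 2) (Metric.ball x' R) :=
    integrableOn_const measure_ball_lt_top.ne
  have hupper : ∫ x in Metric.ball x' R, χ x * (g x + c * ‖x - x'‖ ^ 2)
      ≤ (∫ x in Metric.ball x₀ (2 * R), g x)
        + (volume (Metric.ball x' R)).toReal * (c * R ^ 2) := by
    calc ∫ x in Metric.ball x' R, χ x * (g x + c * ‖x - x'‖ ^ 2)
        ≤ ∫ x in Metric.ball x' R, (g x + c * R ^ 2) := by
          refine setIntegral_mono_on (hf.continuous.integrable_of_hasCompactSupport
            χ.hasCompactSupport.mul_right).integrableOn (hgR.add hconst) measurableSet_ball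
            fun x hx => ?_
          rw [hχ1 x hx, one_mul]
          have : ‖x - x'‖ ≤ R := (mem_ball_iff_norm.1 hx).le
          gcongr
      _ = (∫ x in Metric.ball x' R, g x)
            + (volume (Metric.ball x' R)).toReal * (c * R ^ 2) := by
          rw [integral_add hgR hconst, setIntegral_const, smul_eq_mul, Measure.real]
      _ ≤ _ := by
          refine add_le_add_left ?_ _
          exact setIntegral_mono_set hgint (ae_of_all _ hgnn) hballsub.eventuallyLE
  rw [hχ1 x' (Metric.mem_ball_self hR)] at hmean
  simp only [sub_self, norm_zero, ne_eq, OfNat.ofNat_ne_zero, not_false_eq_true, zero_pow,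
    mul_zero, add_zero, one_mul] at hmean
  have hfinal := hmean.trans hupper
  have hcR : N * R ^ 2 / (2 * d) = c * R ^ 2 := by
    rw [hc]
    ring
  rw [← hvol, hcR, ← sub_le_iff_le_add, le_div_iff₀ hVpos]
  linarith
end

section
/- (Bounded plus semiconvex implies locally Lipschitz.) Let d ≥ 1, x₀ ∈ ℝ^d, R > 0, M ≥ 0, N ≥ 0. Let f : ℝ^d → ℝ be twice continuously differentiable on the open ball B_R(x₀) with |f(x)| ≤ M for all x ∈ B_R(x₀), and suppose the Hessian satisfies D²f(x)(v,v) ≥ −N·‖v‖² for all x ∈ B_R(x₀) and all v ∈ ℝ^d. Then for every x' ∈ B_R(x₀) and every δ > 0 such that the closed ball of radius δ around x' is contained in B_R(x₀), one has ‖∇f(x')‖ ≤ 2M/δ + δ·N/2. -/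
open MeasureTheory Set

/-- Second-order Taylor lower bound for a function with second derivative at least `-K`. -/
theorem taylor_lower_bound_of_neg_le_second_deriv {φ φ' φ'' : ℝ → ℝ} {δ K : ℝ} (hδ : 0 < δ)
    (hφ : ∀ t ∈ Icc 0 δ, HasDerivAt φ (φ' t) t) (hφ' : ∀ t ∈ Icc 0 δ, HasDerivAt φ' (φ'' t) t)
    (hK : ∀ t ∈ Icc 0 δ, -K ≤ φ'' t) :
    φ 0 + δ * φ' 0 - K * δ ^ 2 / 2 ≤ φ δ := by
  have hψ : ∀ t ∈ Icc 0 δ, HasDerivAt (fun s => φ s + K * s ^ 2 / 2) (φ' t + K * t) t := by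
    intro t ht
    refine ((hφ t ht).fun_add (((hasDerivAt_pow 2 t).const_mul K).div_const 2)).congr_deriv ?_
    norm_num
    ring
  have hψ' : ∀ t ∈ Icc 0 δ, HasDerivAt (fun s => φ' s + K * s) (φ'' t + K) t := by
    intro t ht
    simpa using (hφ' t ht).fun_add ((hasDerivAt_id t).const_mul K)
  obtain ⟨c, hc, hcs⟩ := exists_hasDerivAt_eq_slope _ _ hδ
    (fun t ht => (hψ t ht).continuousAt.continuousWithinAt)
    (fun t ht => hψ t (Ioo_subset_Icc_self ht))
  have hsub : Icc 0 c ⊆ Icc 0 δ := Icc_subset_Icc_right hc.2.le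
  obtain ⟨b, hb, hbs⟩ := exists_hasDerivAt_eq_slope _ _ hc.1
    (fun t ht => (hψ' t (hsub ht)).continuousAt.continuousWithinAt)
    (fun t ht => hψ' t (hsub (Ioo_subset_Icc_self ht)))
  have hb0 : 0 ≤ φ'' b + K := by linarith [hK b (hsub (Ioo_subset_Icc_self hb))]
  rw [hbs, sub_zero, le_div_iff₀ hc.1] at hb0
  rw [sub_zero, eq_div_iff hδ.ne'] at hcs
  nlinarith [mul_le_mul_of_nonneg_right hb0 hδ.le]

/-- Second-order Taylor lower bound along a segment for a semiconvex `C²` function. -/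
theorem taylor_lower_bound_of_semiconvex {E : Type*} [NormedAddCommGroup E] [NormedSpace ℝ E]
    {U : Set E} (hU : IsOpen U) {f : E → ℝ} (hf : ContDiffOn ℝ 2 f U) {x v : E} {δ K : ℝ}
    (hδ : 0 < δ) (hseg : ∀ t ∈ Icc 0 δ, x + t • v ∈ U)
    (hK : ∀ y ∈ U, -K ≤ fderiv ℝ (fun z => fderiv ℝ f z v) y v) :
    f x + δ * fderiv ℝ f x v - K * δ ^ 2 / 2 ≤ f (x + δ • v) := by
  have hline (t : ℝ) : HasDerivAt (fun s : ℝ => x + s • v) v t := by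
    simpa using ((hasDerivAt_id t).smul_const v).const_add x
  have hdf : DifferentiableOn ℝ (fderiv ℝ f) U :=
    (hf.fderiv_of_isOpen hU (m := 1) (by norm_num)).differentiableOn (by norm_num)
  have h := taylor_lower_bound_of_neg_le_second_deriv (K := K) hδ
    (φ := fun t => f (x + t • v)) (φ' := fun t => fderiv ℝ f (x + t • v) v)
    (fun t ht => ((hf.differentiableOn (by norm_num)).differentiableAt
      (hU.mem_nhds (hseg t ht))).hasFDerivAt.comp_hasDerivAt t (hline t))
    (fun t ht => HasFDerivAt.comp_hasDerivAt (l := fun z => fderiv ℝ f z v) t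
      ((hdf.differentiableAt (hU.mem_nhds (hseg t ht))).clm_apply
        (differentiableAt_const v)).hasFDerivAt (hline t))
    (fun t ht => hK _ (hseg t ht))
  simpa using h

/-- Bounded plus semiconvex implies locally Lipschitz: if `f` is `C²` on
`B_R(x₀) ⊆ ℝ^d` with `|f| ≤ M` and Hessian `≥ -N·‖·‖²`, then for `x' ∈ B_R(x₀)`
and `δ > 0` with `closedBall x' δ ⊆ B_R(x₀)`, `‖∇f(x')‖ ≤ 2M/δ + δN/2`. -/
theorem bounded_semiconvex_gradient_bound
    (d : ℕ) (hd : 1 ≤ d) (x₀ : EuclideanSpace ℝ (Fin d)) (R M N : ℝ) (hR : 0 < R)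
    (hM : 0 ≤ M) (hN : 0 ≤ N) (f : EuclideanSpace ℝ (Fin d) → ℝ)
    (hfC2 : ContDiffOn ℝ 2 f (Metric.ball x₀ R))
    (hfbd : ∀ x ∈ Metric.ball x₀ R, |f x| ≤ M)
    (hconv : ∀ x ∈ Metric.ball x₀ R, ∀ v : EuclideanSpace ℝ (Fin d),
      -(N * ‖v‖ ^ 2) ≤ fderiv ℝ (fun y => fderiv ℝ f y v) x v)
    (x' : EuclideanSpace ℝ (Fin d)) (hx' : x' ∈ Metric.ball x₀ R)
    (δ : ℝ) (hδ : 0 < δ) (hball : Metric.closedBall x' δ ⊆ Metric.ball x₀ R) :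
    ‖gradient f x'‖ ≤ 2 * M / δ + δ * N / 2 := by
  have hbound : ∀ v : EuclideanSpace ℝ (Fin d), ‖v‖ = 1 →
      fderiv ℝ f x' v ≤ 2 * M / δ + δ * N / 2 := by
    intro v hv
    have hseg : ∀ t ∈ Icc 0 δ, x' + t • v ∈ Metric.ball x₀ R := by
      intro t ht
      apply hball
      simpa [norm_smul, hv, abs_of_nonneg ht.1] using ht.2
    have h := taylor_lower_bound_of_semiconvex Metric.isOpen_ball hfC2 (K := N) hδ hseg
      (fun y hy => by simpa [hv] using hconv y hy v)
    have h₀ := neg_le_of_abs_le (hfbd x' hx')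
    have h₁ := le_of_abs_le (hfbd _ (hseg δ ⟨hδ.le, le_rfl⟩))
    rw [← sub_le_iff_le_add, le_div_iff₀ hδ]
    linarith
  rcases eq_or_ne (gradient f x') 0 with hg | hg
  · rw [hg, norm_zero]
    positivity
  · have hn : ‖gradient f x'‖ ≠ 0 := norm_ne_zero_iff.mpr hg
    have hdir : fderiv ℝ f x' (‖gradient f x'‖⁻¹ • gradient f x') = ‖gradient f x'‖ := by
      rw [map_smul, ← inner_gradient_left, real_inner_self_eq_norm_sq, smul_eq_mul]
      field_simp
    rw [← hdir]
    exact hbound _ (norm_smul_inv_norm (𝕜 := ℝ) hg)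
end

section
/- (Special solutions, λ = 0.) Let μ > 0, c ∈ ℝ, k ∈ ℝ, and G₀ > 0. Define G(t) = G₀/(1 + μ·G₀·t) for t ≥ 0, F(x) = μ·log x + c·x + k for x > 0, and u(t,x) = G(t)·max(F(x), 0). Then for every t > 0 and every x > 0 with F(x) ≠ 0, u is differentiable in t and twice differentiable in x at (t,x), and satisfies ∂_t u(t,x) = x² · u(t,x) · ∂_x² u(t,x). -/
open Set

theorem differentiableAt_and_deriv_deriv_of_eventually_hasDerivAt {f f' : ℝ → ℝ} {x a : ℝ}
    (hf : ∀ᶠ y in nhds x, HasDerivAt f (f' y) y) (hf' : HasDerivAt f' a x) :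
    DifferentiableAt ℝ f x ∧ DifferentiableAt ℝ (deriv f) x ∧ deriv (deriv f) x = a := by
  have hd : deriv f =ᶠ[nhds x] f' := hf.mono fun y hy => hy.deriv
  have h := hf'.congr_of_eventuallyEq hd
  exact ⟨hf.self_of_nhds.differentiableAt, h.differentiableAt, h.deriv⟩

theorem hasDerivAt_div_one_add_mul {μ G₀ t : ℝ} (h : 1 + μ * G₀ * t ≠ 0) :
    HasDerivAt (fun s => G₀ / (1 + μ * G₀ * s)) (-μ * (G₀ / (1 + μ * G₀ * t)) ^ 2) t := by
  have h1 : HasDerivAt (fun s => 1 + μ * G₀ * s) (μ * G₀) t := by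
    simpa using ((hasDerivAt_id t).const_mul (μ * G₀)).const_add 1
  refine ((hasDerivAt_const t G₀).div h1 h).congr_deriv ?_
  field_simp
  ring

theorem hasDerivAt_mul_log_add_mul_add (μ c k : ℝ) {x : ℝ} (hx : x ≠ 0) :
    HasDerivAt (fun y => μ * Real.log y + c * y + k) (μ * x⁻¹ + c) x := by
  simpa using (((Real.hasDerivAt_log hx).const_mul μ).add
    ((hasDerivAt_id x).const_mul c)).add_const k

/-- Special separated-variables solutions for `λ = 0`: with `G(t) = G₀/(1+μG₀t)`,
`F(x) = μ log x + c x + k` and `u(t,x) = G(t)·max(F(x),0)`, for every `t > 0` and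
`x > 0` with `F(x) ≠ 0`, `u` is differentiable in `t`, twice differentiable in `x`,
and satisfies `∂ₜu = x² u ∂ₓ²u`. -/
theorem special_solution_lambda_zero
    (μ c k G₀ : ℝ) (hμ : 0 < μ) (hG₀ : 0 < G₀)
    (u : ℝ → ℝ → ℝ)
    (hu : ∀ t x : ℝ, u t x = (G₀ / (1 + μ * G₀ * t)) * max (μ * Real.log x + c * x + k) 0) :
    ∀ t : ℝ, 0 < t → ∀ x : ℝ, 0 < x → μ * Real.log x + c * x + k ≠ 0 →
      DifferentiableAt ℝ (fun s => u s x) t ∧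
      DifferentiableAt ℝ (fun y => u t y) x ∧
      DifferentiableAt ℝ (deriv (fun y => u t y)) x ∧
      deriv (fun s => u s x) t = x ^ 2 * u t x * deriv (deriv (fun y => u t y)) x := by
  intro t ht x hx hF
  have hden : 1 + μ * G₀ * t ≠ 0 := by positivity
  have hut := (hasDerivAt_div_one_add_mul hden).mul_const (max (μ * Real.log x + c * x + k) 0)
  simp only [hu]
  set G := G₀ / (1 + μ * G₀ * t)
  refine ⟨hut.differentiableAt, ?_⟩
  rw [hut.deriv]
  have hcont := (hasDerivAt_mul_log_add_mul_add μ c k hx.ne').continuousAt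
  rcases lt_or_gt_of_ne hF with hneg | hpos
  · have hev : ∀ᶠ y in nhds x,
        HasDerivAt (fun y => G * max (μ * Real.log y + c * y + k) 0) 0 y := by
      filter_upwards [(hcont.eventually_lt_const hneg).eventually_nhds] with y hy
      refine (hasDerivAt_const y 0).congr_of_eventuallyEq ?_
      filter_upwards [hy] with z hz
      simp [max_eq_right hz.le]
    obtain ⟨h1, h2, -⟩ :=
      differentiableAt_and_deriv_deriv_of_eventually_hasDerivAt hev (hasDerivAt_const x 0)
    exact ⟨h1, h2, by simp [max_eq_right hneg.le]⟩
  · have hev : ∀ᶠ y in nhds x, HasDerivAt (fun y => G * max (μ * Real.log y + c * y + k) 0)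
        (G * (μ * y⁻¹ + c)) y := by
      filter_upwards [(hcont.eventually_const_lt hpos).eventually_nhds, eventually_ne_nhds hx.ne']
        with y hy hy0
      refine ((hasDerivAt_mul_log_add_mul_add μ c k hy0).const_mul G).congr_of_eventuallyEq ?_
      filter_upwards [hy] with z hz
      rw [max_eq_left hz.le]
    obtain ⟨h1, h2, h3⟩ := differentiableAt_and_deriv_deriv_of_eventually_hasDerivAt hev
      ((((hasDerivAt_inv hx.ne').const_mul μ).add_const c).const_mul G)
    refine ⟨h1, h2, ?_⟩
    rw [h3]
    field_simp
end

section
/- (Special solutions, λ > 0: spatial eigenfunction.) Let λ > 0 and μ, c, k ∈ ℝ. Define, for p > λ, F(p) = (μ/2)·log( (p + √(p²−λ²)) / (p − √(p²−λ²)) ) + p·( c − (μ/λ)·arccos(λ/p) ) + k. Then F is twice differentiable on (λ,∞) with F'(p) = c − (μ/λ)·arccos(λ/p) and F''(p) = −μ/( p·√(p²−λ²) ); in particular μ + p·√(p²−λ²)·F''(p) = 0 for all p > λ. -/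
open Set

theorem sqrt_sq_sub_sq_pos {a p : ℝ} (ha : 0 < a) (hp : a < p) :
    0 < Real.sqrt (p ^ 2 - a ^ 2) :=
  Real.sqrt_pos.2 (by nlinarith)

theorem sqrt_sq_sub_sq_lt {a p : ℝ} (ha : 0 < a) (hp : a < p) :
    Real.sqrt (p ^ 2 - a ^ 2) < p :=
  (Real.sqrt_lt' (ha.trans hp)).2 (by nlinarith)

theorem hasDerivAt_sqrt_sq_sub_sq {a p : ℝ} (ha : 0 < a) (hp : a < p) :
    HasDerivAt (fun x : ℝ => Real.sqrt (x ^ 2 - a ^ 2)) (p / Real.sqrt (p ^ 2 - a ^ 2)) p := by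
  have hs := sqrt_sq_sub_sq_pos ha hp
  have h := (((hasDerivAt_id' p).fun_pow 2).sub_const (a ^ 2)).sqrt (Real.sqrt_pos.1 hs).ne'
  refine h.congr_deriv ?_
  field_simp
  simp

theorem hasDerivAt_log_add_sqrt_div_sub_sqrt {a p : ℝ} (ha : 0 < a) (hp : a < p) :
    HasDerivAt (fun x : ℝ => Real.log
      ((x + Real.sqrt (x ^ 2 - a ^ 2)) / (x - Real.sqrt (x ^ 2 - a ^ 2))))
      (2 / Real.sqrt (p ^ 2 - a ^ 2)) p := by
  have hs := sqrt_sq_sub_sq_pos ha hp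
  have hsub := sub_pos.2 (sqrt_sq_sub_sq_lt ha hp)
  have hadd := add_pos (ha.trans hp) hs
  have hd := hasDerivAt_sqrt_sq_sub_sq ha hp
  have h := (((hasDerivAt_id' p).fun_add hd).fun_div ((hasDerivAt_id' p).fun_sub hd) hsub.ne').log
    (div_pos hadd hsub).ne'
  refine h.congr_deriv ?_
  generalize Real.sqrt (p ^ 2 - a ^ 2) = s at *
  field_simp
  ring

theorem hasDerivAt_arccos_const_div {a p : ℝ} (ha : 0 < a) (hp : a < p) :
    HasDerivAt (fun x : ℝ => Real.arccos (a / x))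
      (a / (p * Real.sqrt (p ^ 2 - a ^ 2))) p := by
  have hp0 := ha.trans hp
  have hs := sqrt_sq_sub_sq_pos ha hp
  have hlt : a / p < 1 := (div_lt_one hp0).2 hp
  have hpos : 0 < a / p := div_pos ha hp0
  have h := (Real.hasDerivAt_arccos (by linarith : a / p ≠ -1) hlt.ne).comp p
    ((hasDerivAt_const p a).fun_div (hasDerivAt_id' p) hp0.ne')
  have hsqrt : Real.sqrt (1 - (a / p) ^ 2) = Real.sqrt (p ^ 2 - a ^ 2) / p := by
    rw [show 1 - (a / p) ^ 2 = (p ^ 2 - a ^ 2) / p ^ 2 by field_simp,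
      Real.sqrt_div' _ (sq_nonneg p), Real.sqrt_sq hp0.le]
  refine h.congr_deriv ?_
  simp only [hsqrt]
  field_simp
  ring

/-- Special solutions for `λ > 0`: the spatial eigenfunction
`F(p) = (μ/2)·log((p+√(p²−λ²))/(p−√(p²−λ²))) + p(c − (μ/λ)·arccos(λ/p)) + k`
is twice differentiable on `(λ,∞)` with `F'(p) = c − (μ/λ)·arccos(λ/p)` and
`F''(p) = −μ/(p√(p²−λ²))`; in particular `μ + p√(p²−λ²)·F''(p) = 0`. -/
theorem special_solution_lambda_pos_eigenfunction
    (lam μ c k : ℝ) (hlam : 0 < lam) (F : ℝ → ℝ)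
    (hF : ∀ p : ℝ, lam < p → F p =
      (μ / 2) * Real.log ((p + Real.sqrt (p ^ 2 - lam ^ 2)) / (p - Real.sqrt (p ^ 2 - lam ^ 2)))
        + p * (c - (μ / lam) * Real.arccos (lam / p)) + k) :
    ∀ p : ℝ, lam < p →
      DifferentiableAt ℝ F p ∧
      DifferentiableAt ℝ (deriv F) p ∧
      deriv F p = c - (μ / lam) * Real.arccos (lam / p) ∧
      deriv (deriv F) p = -μ / (p * Real.sqrt (p ^ 2 - lam ^ 2)) ∧
      μ + p * Real.sqrt (p ^ 2 - lam ^ 2) * deriv (deriv F) p = 0 := by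
  have hA (p : ℝ) (hp : lam < p) :
      HasDerivAt (fun x : ℝ => c - (μ / lam) * Real.arccos (lam / x))
        (-μ / (p * Real.sqrt (p ^ 2 - lam ^ 2))) p := by
    have hp0 := hlam.trans hp
    have hs := sqrt_sq_sub_sq_pos hlam hp
    refine (((hasDerivAt_arccos_const_div hlam hp).const_mul (μ / lam)).const_sub c).congr_deriv ?_
    field_simp
  have hD (p : ℝ) (hp : lam < p) :
      HasDerivAt F (c - (μ / lam) * Real.arccos (lam / p)) p := by
    have hp0 := hlam.trans hp
    have hs := sqrt_sq_sub_sq_pos hlam hp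
    have h := (((hasDerivAt_log_add_sqrt_div_sub_sqrt hlam hp).const_mul (μ / 2)).fun_add
      ((hasDerivAt_id' p).fun_mul (hA p hp))).add_const k
    have hFp := h.congr_of_eventuallyEq ((eventually_gt_nhds hp).mono hF)
    refine hFp.congr_deriv ?_
    field_simp
    ring
  intro p hp
  have hp0 := hlam.trans hp
  have hs := sqrt_sq_sub_sq_pos hlam hp
  have hDD : HasDerivAt (deriv F) (-μ / (p * Real.sqrt (p ^ 2 - lam ^ 2))) p :=
    (hA p hp).congr_of_eventuallyEq ((eventually_gt_nhds hp).mono fun x hx => (hD x hx).deriv)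
  refine ⟨(hD p hp).differentiableAt, hDD.differentiableAt, (hD p hp).deriv, hDD.deriv, ?_⟩
  rw [hDD.deriv]
  field_simp
  ring
end
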